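/- Let (R, m, k) be a Cohen–Macaulay local ring of dimension d and I an m-primary ideal. Suppose x₁, …, x_d is a system of parameters with m^r ⊆ (x₁,…,x_d) ⊆ I for some r ≥ 1. Then for every maximal Cohen–Macaulay R-module M with I ⊆ ann̲_R(M), the first syzygy Ω_R M belongs to the subcategory |Ω_R^d k ⊕ R|_{r-1}, the smallest class of finitely generated modules built from Ω_R^d k ⊕ R by taking finite direct sums, direct summands, and at most r−2 extensions. -/

import Mathlib

open IsLocalRing

/-- a lies in the stable annihilator of M: multiplication by a on M factors
through a finitely generated projective R-module. -/
def StablyAnn (R : Type) [CommRing R] (M : Type) [AddCommGroup M] [Module R M] (a : R) : Prop :=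
  ∃ (P : Type) (_ : AddCommGroup P) (_ : Module R P),
    Module.Finite R P ∧ Module.Projective R P ∧
    ∃ (f : M →ₗ[R] P) (g : P →ₗ[R] M), g ∘ₗ f = a • (LinearMap.id : M →ₗ[R] M)

/-- The Ext module of two module-category objects. -/
noncomputable def ExtMod (R : Type) [CommRing R] (n : ℕ) (M N : ModuleCat.{0} R) : ModuleCat R :=
  ((Ext R (ModuleCat.{0} R) n).obj (Opposite.op M)).obj N

/-- K is an n-th syzygy of M: there is an exact sequence
0 → K → F_{n-1} → ... → F_0 → M → 0 with finitely generated free modules F_i. -/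
def IsSyzygyCat (R : Type) [CommRing R] : ℕ → ModuleCat.{0} R → ModuleCat.{0} R → Prop
  | 0, K, M => Nonempty (K ≃ₗ[R] M)
  | n + 1, K, M =>
      ∃ (s : ℕ) (p : (Fin s → R) →ₗ[R] M), Function.Surjective p ∧
        IsSyzygyCat R n K (ModuleCat.of R (LinearMap.ker p))

/-- M is a direct summand of Z. -/
def IsSummand (R : Type) [CommRing R] (M Z : ModuleCat.{0} R) : Prop :=
  ∃ (i : M →ₗ[R] Z) (p : Z →ₗ[R] M), p ∘ₗ i = LinearMap.id

/-- The class |X|_n of modules built from X by n-1 extensions together with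
finite direct sums and direct summands. -/
def Ball (R : Type) [CommRing R] (X : ModuleCat.{0} R) : ℕ → ModuleCat.{0} R → Prop
  | 0, M => Subsingleton M
  | 1, M => ∃ s : ℕ, IsSummand R M (ModuleCat.of R (Fin s → X))
  | (n + 2), M =>
      ∃ (A Z B : ModuleCat.{0} R) (f : A →ₗ[R] Z) (g : Z →ₗ[R] B),
        Function.Injective f ∧ Function.Surjective g ∧ LinearMap.range f = LinearMap.ker g ∧
        Ball R X (n + 1) A ∧ Ball R X 1 B ∧ IsSummand R M Z


section StableSyzygies

variable {R : Type} [CommRing R]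

/-- `A` is a direct summand of `B` up to a finite free module: the identity of `A` is the sum of
an endomorphism factoring through `B` and one factoring through a finite free module. -/
def StablySummand (R : Type) [CommRing R] (A B : Type) [AddCommGroup A] [Module R A]
    [AddCommGroup B] [Module R B] : Prop :=
  ∃ (s : ℕ) (α : A →ₗ[R] B) (β : B →ₗ[R] A) (u : A →ₗ[R] (Fin s → R)) (v : (Fin s → R) →ₗ[R] A),
    ∀ a, β (α a) + v (u a) = a

/-- The pullback of `p : F → C` along multiplication by `x` on `C`. -/
def smulPullback {F C : Type} [AddCommGroup F] [Module R F] [AddCommGroup C] [Module R C]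
    (x : R) (p : F →ₗ[R] C) : Submodule R (F × C) :=
  LinearMap.ker (p ∘ₗ LinearMap.fst R F C - x • LinearMap.snd R F C)

variable {A B C F H : Type} [AddCommGroup A] [Module R A] [AddCommGroup B] [Module R B]
  [AddCommGroup C] [Module R C] [AddCommGroup F] [Module R F] [AddCommGroup H] [Module R H]

lemma mem_smulPullback {x : R} {p : F →ₗ[R] C} {z : F × C} :
    z ∈ smulPullback x p ↔ p z.1 = x • z.2 := by
  simp [smulPullback, sub_eq_zero]

lemma exists_finite_free_lift [Module.Finite R A] :
    ∃ (s : ℕ) (p : (Fin s → R) →ₗ[R] A), Function.Surjective p :=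
  Module.Finite.exists_fin' R A

lemma IsSyzygyCat.congr_right {n : ℕ} {K : ModuleCat.{0} R} (e : A ≃ₗ[R] B)
    (h : IsSyzygyCat R n K (ModuleCat.of R A)) : IsSyzygyCat R n K (ModuleCat.of R B) := by
  induction n generalizing A B with
  | zero =>
    obtain ⟨f⟩ := h
    exact ⟨f.trans e⟩
  | succ n ih =>
    obtain ⟨s, p, hp, h⟩ := h
    refine ⟨s, e.toLinearMap ∘ₗ p, e.surjective.comp hp, ih (LinearEquiv.ofEq _ _ ?_) h⟩
    exact (LinearEquiv.ker_comp e p).symm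

lemma IsSyzygyCat.succ_of_free {n : ℕ} {K : ModuleCat.{0} R} [Module.Free R F] [Module.Finite R F]
    {p : F →ₗ[R] A} (hp : Function.Surjective p)
    (h : IsSyzygyCat R n K (ModuleCat.of R (LinearMap.ker p))) :
    IsSyzygyCat R (n + 1) K (ModuleCat.of R A) := by
  obtain ⟨s, ⟨e⟩⟩ : ∃ s : ℕ, Nonempty (F ≃ₗ[R] (Fin s → R)) := by
    let b := Module.Free.chooseBasis R F
    exact ⟨_, ⟨(b.reindex (Fintype.equivFin _)).equivFun⟩⟩
  refine ⟨s, p ∘ₗ e.symm.toLinearMap, hp.comp e.symm.surjective, h.congr_right ?_⟩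
  refine LinearEquiv.ofSubmodules e _ _ ?_
  ext y
  constructor
  · rintro ⟨z, hz, rfl⟩
    simpa using hz
  · intro hy
    exact ⟨e.symm y, by simpa using hy, by simp⟩

/-- Over a free cover, the pullback along multiplication by `x` commutes with taking syzygies. -/
lemma IsSyzygyCat.succ_smulPullback {n : ℕ} {K : ModuleCat.{0} R} {x : R} [Module.Free R F]
    [Module.Finite R F] [Module.Free R H] [Module.Finite R H] {p : F →ₗ[R] C}
    (hp : Function.Surjective p) {π : H →ₗ[R] LinearMap.ker p} (hπ : Function.Surjective π)
    (h : IsSyzygyCat R n K (ModuleCat.of R (smulPullback x π))) :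
    IsSyzygyCat R (n + 1) K (ModuleCat.of R (smulPullback x p)) := by
  let φ₀ : H × F →ₗ[R] F × C :=
    (((LinearMap.ker p).subtype ∘ₗ π).coprod (x • LinearMap.id)).prod (p ∘ₗ LinearMap.snd R H F)
  have hφ₀ : ∀ z, φ₀ z ∈ smulPullback x p := by
    intro z
    simp [φ₀, mem_smulPullback]
  let φ := φ₀.codRestrict _ hφ₀
  have hφ : Function.Surjective φ := by
    rintro ⟨⟨a, c⟩, hz⟩
    rw [mem_smulPullback] at hz
    obtain ⟨g, rfl⟩ := hp c
    obtain ⟨b, hb⟩ := hπ ⟨a - x • g, by simpa [sub_eq_zero] using hz⟩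
    refine ⟨(b, g), Subtype.ext ?_⟩
    simp [φ, φ₀, hb]
  refine IsSyzygyCat.succ_of_free hφ (h.congr_right ?_)
  have key : ∀ z : H × F, z ∈ LinearMap.ker φ ↔ p z.2 = 0 ∧ (π z.1 : F) + x • z.2 = 0 := by
    intro z
    rw [LinearMap.mem_ker, ← Subtype.coe_inj]
    simp [φ, φ₀, and_comm]
  let ψ : H × LinearMap.ker p →ₗ[R] H × F :=
    LinearMap.prodMap LinearMap.id (-(LinearMap.ker p).subtype)
  have hψ : Function.Injective ψ := by
    rintro ⟨a, b⟩ ⟨a', b'⟩ hab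
    simpa [ψ, Subtype.coe_inj] using hab
  refine LinearEquiv.ofBijective (ψ.restrict (p := smulPullback x π) (q := LinearMap.ker φ) ?_)
    ⟨fun a b hab => Subtype.ext (hψ (congrArg Subtype.val hab)), ?_⟩
  · intro z hz
    rw [mem_smulPullback] at hz
    rw [key]
    simp [ψ, hz]
  · rintro ⟨z, hz⟩
    obtain ⟨hz₁, hz₂⟩ := (key z).1 hz
    refine ⟨⟨(z.1, ⟨-z.2, by simpa using hz₁⟩), mem_smulPullback.2 (Subtype.ext ?_)⟩, ?_⟩
    · rw [eq_neg_of_add_eq_zero_left hz₂]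
      exact (smul_neg x z.2).symm
    · ext <;> simp [ψ]

lemma IsSyzygyCat.exists_smulPullback {n : ℕ} (x : R) {K : ModuleCat.{0} R}
    (h : IsSyzygyCat R n K (ModuleCat.of R C)) [Module.Free R H] [Module.Finite R H]
    {π : H →ₗ[R] K} (hπ : Function.Surjective π) :
    ∃ (F : Type) (_ : AddCommGroup F) (_ : Module R F) (_ : Module.Free R F)
      (_ : Module.Finite R F) (p : F →ₗ[R] C), Function.Surjective p ∧
      IsSyzygyCat R n (ModuleCat.of R (smulPullback x π)) (ModuleCat.of R (smulPullback x p)) := by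
  induction n generalizing C with
  | zero =>
    obtain ⟨e⟩ := h
    refine ⟨H, _, _, ‹_›, ‹_›, e.toLinearMap ∘ₗ π, e.surjective.comp hπ, ⟨?_⟩⟩
    refine LinearEquiv.ofSubmodules ((LinearEquiv.refl R H).prodCongr e) _ _ ?_
    ext ⟨a, c⟩
    constructor
    · rintro ⟨z, hz, h⟩
      have hz := mem_smulPullback.1 hz
      obtain ⟨rfl, rfl⟩ := Prod.ext_iff.1 h
      simp [mem_smulPullback, hz]
    · intro hz
      have hz := mem_smulPullback.1 hz
      refine ⟨(a, e.symm c), mem_smulPullback.2 (e.injective ?_), by simp⟩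
      simpa using hz
  | succ n ih =>
    obtain ⟨s, p, hp, h⟩ := h
    obtain ⟨F, _, _, _, _, q, hq, h'⟩ := ih h
    exact ⟨_, _, _, inferInstance, inferInstance, p, hp, h'.succ_smulPullback hp hq⟩

/-- The pullback of a free cover along multiplication by a `C`-regular element `x` is a first
syzygy of `C / x C`. -/
lemma IsSyzygyCat.succ_of_smulPullback {n : ℕ} {K : ModuleCat.{0} R} {x : R} [Module.Free R F]
    [Module.Finite R F] {p : F →ₗ[R] C} (hp : Function.Surjective p) {q : C →ₗ[R] B}
    (hq : Function.Surjective q) (hker : ∀ c, q c = 0 ↔ ∃ c', x • c' = c)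
    (hx : IsSMulRegular C x)
    (h : IsSyzygyCat R n K (ModuleCat.of R (smulPullback x p))) :
    IsSyzygyCat R (n + 1) K (ModuleCat.of R B) := by
  refine IsSyzygyCat.succ_of_free (p := q ∘ₗ p) (hq.comp hp) (h.congr_right ?_)
  refine LinearEquiv.ofBijective ((LinearMap.fst R F C).restrict (p := smulPullback x p)
    (q := LinearMap.ker (q ∘ₗ p)) ?_) ⟨?_, ?_⟩
  · intro z hz
    exact (hker _).2 ⟨z.2, (mem_smulPullback.1 hz).symm⟩
  · rintro ⟨⟨a, c⟩, hz⟩ ⟨⟨a', c'⟩, hz'⟩ h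
    have h : a = a' := congrArg Subtype.val h
    have hz := mem_smulPullback.1 hz
    have hz' := mem_smulPullback.1 hz'
    subst h
    have : c = c' := hx (hz.symm.trans hz')
    subst this
    rfl
  · rintro ⟨a, ha⟩
    obtain ⟨c, hc⟩ := (hker _).1 ha
    exact ⟨⟨(a, c), mem_smulPullback.2 hc.symm⟩, rfl⟩

lemma StablyAnn.exists_lift {x : R} (hx : StablyAnn R A x) {p : F →ₗ[R] C}
    (hp : Function.Surjective p) (α : A →ₗ[R] C) :
    ∃ σ : A →ₗ[R] F, ∀ a, p (σ a) = x • α a := by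
  obtain ⟨P, _, _, _, _, f, g, hfg⟩ := hx
  obtain ⟨l, hl⟩ := Module.projective_lifting_property p (α ∘ₗ g) hp
  refine ⟨l ∘ₗ f, fun a => ?_⟩
  have h1 := LinearMap.congr_fun hl (f a)
  have h2 := LinearMap.congr_fun hfg a
  simp only [LinearMap.comp_apply, LinearMap.smul_apply, LinearMap.id_apply] at h1 h2 ⊢
  rw [h1, h2, map_smul]

lemma StablySummand.smulPullback {x : R} (hx : StablyAnn R A x) (h : StablySummand R A C)
    {p : F →ₗ[R] C} (hp : Function.Surjective p) : StablySummand R A (smulPullback x p) := by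
  obtain ⟨s, α, β, u, v, h⟩ := h
  obtain ⟨σ, hσ⟩ := hx.exists_lift hp α
  refine ⟨s, (σ.prod α).codRestrict _ fun a => mem_smulPullback.2 (hσ a),
    β ∘ₗ LinearMap.snd R F C ∘ₗ (_root_.smulPullback x p).subtype, u, v, fun a => ?_⟩
  simpa using h a

lemma StablyAnn.ker {x : R} (hx : StablyAnn R C x) [Module.Free R F] [Module.Finite R F]
    {p : F →ₗ[R] C} (hp : Function.Surjective p) : StablyAnn R (LinearMap.ker p) x := by
  obtain ⟨σ, hσ⟩ := hx.exists_lift hp LinearMap.id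
  refine ⟨F, _, _, inferInstance, inferInstance, (LinearMap.ker p).subtype,
    (x • LinearMap.id - σ ∘ₗ p).codRestrict _ fun a => by simp [hσ], ?_⟩
  refine LinearMap.ext fun a => Subtype.ext ?_
  have : p a.1 = 0 := a.2
  simp [this]

/-- Stable summands pass to syzygies. -/
lemma StablySummand.ker {s t : ℕ} (h : StablySummand R A B) {p : (Fin s → R) →ₗ[R] A}
    (hp : Function.Surjective p) {q : (Fin t → R) →ₗ[R] B} (hq : Function.Surjective q) :
    StablySummand R (LinearMap.ker p) (LinearMap.ker q) := by
  obtain ⟨_, α, β, u, v, h⟩ := h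
  obtain ⟨a, ha⟩ := Module.projective_lifting_property q (α ∘ₗ p) hq
  obtain ⟨b, hb⟩ := Module.projective_lifting_property p (β ∘ₗ q) hp
  obtain ⟨w, hw⟩ := Module.projective_lifting_property p v hp
  have ha' := LinearMap.congr_fun ha
  have hb' := LinearMap.congr_fun hb
  have hw' := LinearMap.congr_fun hw
  simp only [LinearMap.comp_apply] at ha' hb' hw'
  let θ : (Fin s → R) →ₗ[R] (Fin s → R) := LinearMap.id - b ∘ₗ a - w ∘ₗ u ∘ₗ p
  have hθ : ∀ z, θ z ∈ LinearMap.ker p := by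
    intro z
    have := h (p z)
    simp only [θ, LinearMap.mem_ker, LinearMap.sub_apply, LinearMap.id_apply, LinearMap.comp_apply,
      map_sub, hb', ha', hw']
    rw [sub_sub, this, sub_self]
  refine ⟨s, a.restrict (q := LinearMap.ker q) ?_, b.restrict (q := LinearMap.ker p) ?_,
    (LinearMap.ker p).subtype, θ.codRestrict _ hθ, fun z => Subtype.ext ?_⟩
  · intro z hz
    rw [LinearMap.mem_ker] at hz ⊢
    rw [ha', hz, map_zero]
  · intro z hz
    rw [LinearMap.mem_ker] at hz ⊢
    rw [hb', hz, map_zero]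
  · have : p z.1 = 0 := z.2
    simp [θ, this]

lemma StablySummand.syzygy {n : ℕ} {K L : ModuleCat.{0} R} (h : StablySummand R A B)
    (hK : IsSyzygyCat R n K (ModuleCat.of R A)) (hL : IsSyzygyCat R n L (ModuleCat.of R B)) :
    StablySummand R K L := by
  induction n generalizing A B with
  | zero =>
    obtain ⟨e⟩ := hK
    obtain ⟨f⟩ := hL
    obtain ⟨s, α, β, u, v, h⟩ := h
    refine ⟨s, f.symm.toLinearMap ∘ₗ α ∘ₗ e.toLinearMap, e.symm.toLinearMap ∘ₗ β ∘ₗ f.toLinearMap,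
      u ∘ₗ e.toLinearMap, e.symm.toLinearMap ∘ₗ v, fun a => e.injective ?_⟩
    simpa using h (e a)
  | succ n ih =>
    obtain ⟨s, p, hp, hK⟩ := hK
    obtain ⟨t, q, hq, hL⟩ := hL
    exact ih (h.ker hp hq) hK hL

lemma StablySummand.rfl : StablySummand R A A :=
  ⟨0, LinearMap.id, LinearMap.id, 0, 0, by simp⟩

lemma StablySummand.trans (h : StablySummand R A B) (h' : StablySummand R B C) :
    StablySummand R A C := by
  obtain ⟨s, α, β, u, v, h⟩ := h
  obtain ⟨t, γ, δ, w, y, h'⟩ := h'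
  let e := (LinearEquiv.sumArrowLequivProdArrow (Fin s) (Fin t) R R).symm.trans
    (LinearEquiv.funCongrLeft R R finSumFinEquiv.symm)
  refine ⟨s + t, γ ∘ₗ α, β ∘ₗ δ, e.toLinearMap ∘ₗ u.prod (w ∘ₗ α),
    v.coprod (β ∘ₗ y) ∘ₗ e.symm.toLinearMap, fun a => ?_⟩
  have h1 := h a
  rw [← h' (α a), map_add] at h1
  simp only [LinearMap.comp_apply, LinearEquiv.coe_coe, LinearEquiv.symm_apply_apply,
    LinearMap.coprod_apply, LinearMap.prod_apply, Function.prod_apply]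
  rw [← add_assoc, add_right_comm]
  exact h1

end StableSyzygies

section Balls

variable {R : Type} [CommRing R]

variable {A B C K₁ K₂ : Type} [AddCommGroup A] [Module R A] [AddCommGroup B] [Module R B]
  [AddCommGroup C] [Module R C] [AddCommGroup K₁] [Module R K₁] [AddCommGroup K₂] [Module R K₂]

/-- The horseshoe lemma. -/
lemma IsSyzygyCat.horseshoe {n : ℕ} {f : A →ₗ[R] B} {g : B →ₗ[R] C} (hf : Function.Injective f)
    (hg : Function.Surjective g) (hfg : LinearMap.range f = LinearMap.ker g)
    (h₁ : IsSyzygyCat R n (ModuleCat.of R K₁) (ModuleCat.of R A))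
    (h₂ : IsSyzygyCat R n (ModuleCat.of R K₂) (ModuleCat.of R C)) :
    ∃ (K : ModuleCat.{0} R) (f' : K₁ →ₗ[R] K) (g' : K →ₗ[R] K₂),
      IsSyzygyCat R n K (ModuleCat.of R B) ∧ Function.Injective f' ∧ Function.Surjective g' ∧
      LinearMap.range f' = LinearMap.ker g' := by
  induction n generalizing A B C with
  | zero =>
    obtain ⟨e⟩ := h₁
    obtain ⟨e'⟩ := h₂
    refine ⟨ModuleCat.of R B, f ∘ₗ e.toLinearMap, e'.symm.toLinearMap ∘ₗ g,
      ⟨LinearEquiv.refl R B⟩, hf.comp e.injective, e'.symm.surjective.comp hg, ?_⟩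
    rw [LinearEquiv.ker_comp, ← hfg]
    exact LinearEquiv.range_comp e f
  | succ n ih =>
    obtain ⟨s, p, hp, h₁⟩ := h₁
    obtain ⟨t, q, hq, h₂⟩ := h₂
    obtain ⟨q', hq'⟩ := Module.projective_lifting_property g q hg
    have hq' : ∀ y, g (q' y) = q y := LinearMap.congr_fun hq'
    have hgf : ∀ y, g (f y) = 0 := fun y => by
      rw [← LinearMap.mem_ker, ← hfg]
      exact ⟨y, rfl⟩
    have hmem : ∀ b, g b = 0 → ∃ a, f a = b := fun b hb => by
      rwa [← LinearMap.mem_ker, ← hfg] at hb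
    let φ : (Fin s → R) × (Fin t → R) →ₗ[R] B := (f ∘ₗ p).coprod q'
    have hφ : ∀ z, φ z = f (p z.1) + q' z.2 := fun z => rfl
    have hφs : Function.Surjective φ := by
      intro b
      obtain ⟨y, hy⟩ := hq (g b)
      obtain ⟨a, ha⟩ := hmem (b - q' y) (by rw [map_sub, hq', hy, sub_self])
      obtain ⟨w, rfl⟩ := hp a
      exact ⟨(w, y), by rw [hφ, ha, sub_add_cancel]⟩
    let i : LinearMap.ker p →ₗ[R] LinearMap.ker φ :=
      (LinearMap.inl R (Fin s → R) (Fin t → R)).restrict fun z hz => by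
        rw [LinearMap.mem_ker] at hz ⊢
        simp [hφ, hz]
    let j : LinearMap.ker φ →ₗ[R] LinearMap.ker q :=
      (LinearMap.snd R (Fin s → R) (Fin t → R)).restrict fun z hz => by
        rw [LinearMap.mem_ker] at hz ⊢
        have := congrArg g hz
        rwa [hφ, map_add, hgf, zero_add, map_zero, hq'] at this
    have hi : Function.Injective i := fun a b hab =>
      Subtype.ext (congrArg (fun z => z.1.1) hab)
    have hj : Function.Surjective j := by
      rintro ⟨y, hy⟩
      obtain ⟨a, ha⟩ := hmem (-q' y) (by rw [map_neg, hq', LinearMap.mem_ker.1 hy, neg_zero])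
      obtain ⟨w, rfl⟩ := hp a
      exact ⟨⟨(w, y), by rw [LinearMap.mem_ker, hφ, ha, neg_add_cancel]⟩, rfl⟩
    have hij : LinearMap.range i = LinearMap.ker j := by
      ext ⟨⟨a, b⟩, hz⟩
      rw [LinearMap.mem_ker] at hz
      constructor
      · rintro ⟨z, hz⟩
        have : (0 : Fin t → R) = b := congrArg (fun z => z.1.2) hz
        subst this
        rfl
      · intro hb
        have hb : b = 0 := congrArg Subtype.val (LinearMap.mem_ker.1 hb)
        subst hb
        rw [hφ, map_zero, add_zero] at hz
        exact ⟨⟨a, hf (by simpa using hz)⟩, rfl⟩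
    obtain ⟨K, f', g', hK, h⟩ := ih hi hj hij h₁ h₂
    exact ⟨K, f', g', IsSyzygyCat.succ_of_free hφs hK, h⟩

lemma IsSyzygyCat.pi {n : ℕ} (m : ℕ) {K : ModuleCat.{0} R}
    (h : IsSyzygyCat R n K (ModuleCat.of R A)) :
    IsSyzygyCat R n (ModuleCat.of R (Fin m → K)) (ModuleCat.of R (Fin m → A)) := by
  induction n generalizing A with
  | zero =>
    obtain ⟨e⟩ := h
    exact ⟨LinearEquiv.piCongrRight fun _ => e⟩
  | succ n ih =>
    obtain ⟨s, p, hp, h⟩ := h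
    let φ : (Fin m → Fin s → R) →ₗ[R] (Fin m → A) := LinearMap.pi fun i => p ∘ₗ LinearMap.proj i
    have hφ : Function.Surjective φ := by
      intro a
      choose w hw using fun i => hp (a i)
      exact ⟨w, funext hw⟩
    refine IsSyzygyCat.succ_of_free hφ ((ih h).congr_right ?_)
    have key : ∀ z, z ∈ LinearMap.ker φ ↔ ∀ i, p (z i) = 0 := fun z => by
      rw [LinearMap.mem_ker, funext_iff]
      rfl
    exact
      { toFun := fun z => ⟨fun i => (z i).1, (key _).2 fun i => (z i).2⟩
        invFun := fun z i => ⟨z.1 i, (key _).1 z.2 i⟩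
        map_add' := fun _ _ => rfl
        map_smul' := fun _ _ => rfl }

lemma IsSummand.trans {L M N : ModuleCat.{0} R} (h : IsSummand R L M) (h' : IsSummand R M N) :
    IsSummand R L N := by
  obtain ⟨i, p, hp⟩ := h
  obtain ⟨j, q, hq⟩ := h'
  refine ⟨j ∘ₗ i, p ∘ₗ q, LinearMap.ext fun a => ?_⟩
  have h1 := LinearMap.congr_fun hq (i a)
  have h2 := LinearMap.congr_fun hp a
  simp only [LinearMap.comp_apply, LinearMap.id_apply] at h1 h2 ⊢
  rw [h1, h2]

lemma ball_one {X M : ModuleCat.{0} R} :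
    Ball R X 1 M ↔ ∃ s : ℕ, IsSummand R M (ModuleCat.of R (Fin s → X)) := by
  rw [Ball]

lemma ball_add_two {X M : ModuleCat.{0} R} {n : ℕ} :
    Ball R X (n + 2) M ↔ ∃ (A Z B : ModuleCat.{0} R) (f : A →ₗ[R] Z) (g : Z →ₗ[R] B),
      Function.Injective f ∧ Function.Surjective g ∧ LinearMap.range f = LinearMap.ker g ∧
      Ball R X (n + 1) A ∧ Ball R X 1 B ∧ IsSummand R M Z := by
  rw [Ball]

lemma Ball.of_isSummand {X L M : ModuleCat.{0} R} {n : ℕ} (h : IsSummand R L M)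
    (hM : Ball R X (n + 1) M) : Ball R X (n + 1) L := by
  cases n with
  | zero =>
    obtain ⟨s, hs⟩ := ball_one.1 hM
    exact ball_one.2 ⟨s, h.trans hs⟩
  | succ n =>
    obtain ⟨A, Z, B, f, g, hf, hg, hfg, hA, hB, hs⟩ := ball_add_two.1 hM
    exact ball_add_two.2 ⟨A, Z, B, f, g, hf, hg, hfg, hA, hB, h.trans hs⟩

lemma Ball.prod_free (t : ℕ) {K M : ModuleCat.{0} R} {n : ℕ}
    (hM : Ball R (ModuleCat.of R (K × R : Type)) (n + 1) M) :
    Ball R (ModuleCat.of R (K × R : Type)) (n + 1)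
      (ModuleCat.of R (M × (Fin t → R) : Type)) := by
  induction n generalizing M with
  | zero =>
    obtain ⟨s, i, p, hip⟩ := ball_one.1 hM
    refine ball_one.2 ⟨s + t, ?_⟩
    let e : (Fin s ⊕ Fin t → K × R) ≃ₗ[R] (Fin (s + t) → K × R) :=
      LinearEquiv.funCongrLeft R _ finSumFinEquiv.symm
    let e' := (LinearEquiv.sumArrowLequivProdArrow (Fin s) (Fin t) R (K × R)).symm.trans e
    let a : (Fin t → R) →ₗ[R] (Fin t → K × R) :=
      LinearMap.pi fun j => LinearMap.inr R K R ∘ₗ LinearMap.proj j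
    let b : (Fin t → K × R) →ₗ[R] (Fin t → R) :=
      LinearMap.pi fun j => LinearMap.snd R K R ∘ₗ LinearMap.proj j
    refine ⟨e'.toLinearMap ∘ₗ LinearMap.prodMap i a, LinearMap.prodMap p b ∘ₗ e'.symm.toLinearMap,
      LinearMap.ext fun z => ?_⟩
    have h1 := LinearMap.congr_fun hip z.1
    simp only [LinearMap.comp_apply, LinearMap.id_apply] at h1
    simp only [LinearMap.comp_apply, LinearEquiv.coe_coe, LinearEquiv.symm_apply_apply,
      LinearMap.id_apply, LinearMap.prodMap_apply, h1]
    rfl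
  | succ n ih =>
    obtain ⟨A, Z, B, f, g, hf, hg, hfg, hA, hB, i, p, hip⟩ := ball_add_two.1 hM
    refine ball_add_two.2 ⟨ModuleCat.of R (A × (Fin t → R) : Type),
      ModuleCat.of R (Z × (Fin t → R) : Type), B,
      LinearMap.prodMap f LinearMap.id, g ∘ₗ LinearMap.fst R Z (Fin t → R),
      hf.prodMap Function.injective_id, hg.comp Prod.fst_surjective, ?_, ih hA, hB,
      LinearMap.prodMap i LinearMap.id, LinearMap.prodMap p LinearMap.id, ?_⟩
    · ext ⟨z, w⟩
      have hz : z ∈ LinearMap.range f ↔ z ∈ LinearMap.ker g := by rw [hfg]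
      simp only [LinearMap.mem_ker, LinearMap.comp_apply, LinearMap.fst_apply] at hz ⊢
      rw [← hz]
      constructor
      · rintro ⟨y, hy⟩
        exact ⟨y.1, congrArg Prod.fst hy⟩
      · rintro ⟨y, rfl⟩
        exact ⟨(y, w), rfl⟩
    · refine LinearMap.ext fun z => Prod.ext (LinearMap.congr_fun hip z.1) rfl

lemma Ball.of_stablySummand {K L M : ModuleCat.{0} R} {n : ℕ} (h : StablySummand R L M)
    (hM : Ball R (ModuleCat.of R (K × R : Type)) (n + 1) M) :
    Ball R (ModuleCat.of R (K × R : Type)) (n + 1) L := by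
  obtain ⟨s, α, β, u, v, h⟩ := h
  exact .of_isSummand ⟨α.prod u, β.coprod v, LinearMap.ext h⟩ (hM.prod_free s)

/-- A finitely generated module killed by `𝔪` is a finite direct sum of copies of `R ⧸ 𝔪`. -/
lemma exists_linearEquiv_pi_residue [IsLocalRing R] [Module.Finite R A]
    (hA : ∀ y ∈ maximalIdeal R, ∀ a : A, y • a = 0) :
    ∃ s : ℕ, Nonempty ((Fin s → R ⧸ maximalIdeal R) ≃ₗ[R] A) := by
  have htors : Module.IsTorsionBySet R A (maximalIdeal R) := fun a y => hA y.1 y.2 a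
  let := htors.module
  let : Field (R ⧸ maximalIdeal R) := Ideal.Quotient.field _
  have : IsScalarTower R (R ⧸ maximalIdeal R) A := htors.isScalarTower
  have : Module.Finite (R ⧸ maximalIdeal R) A := Module.Finite.of_restrictScalars_finite R _ _
  exact ⟨_, ⟨((Module.finBasis (R ⧸ maximalIdeal R) A).equivFun.restrictScalars R).symm⟩⟩

/-- The Loewy filtration of a module killed by `𝔪 ^ (n + 1)` bounds the number of extensions
needed to build its syzygies from those of the residue field. -/
lemma exists_syzygy_ball [IsNoetherianRing R] [IsLocalRing R] {d : ℕ} {K : ModuleCat.{0} R}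
    (hK : IsSyzygyCat R d K (ModuleCat.of R (R ⧸ maximalIdeal R))) (n : ℕ) [Module.Finite R A]
    (hA : ∀ y ∈ maximalIdeal R ^ (n + 1), ∀ a : A, y • a = 0) :
    ∃ L : ModuleCat.{0} R, IsSyzygyCat R d L (ModuleCat.of R A) ∧
      Ball R (ModuleCat.of R (K × R : Type)) (n + 1) L := by
  have base : ∀ (A : Type) [AddCommGroup A] [Module R A] [Module.Finite R A]
      (_ : ∀ y ∈ maximalIdeal R, ∀ a : A, y • a = 0), ∃ L : ModuleCat.{0} R,
      IsSyzygyCat R d L (ModuleCat.of R A) ∧ Ball R (ModuleCat.of R (K × R : Type)) 1 L := by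
    intro A _ _ _ hA
    obtain ⟨s, ⟨e⟩⟩ := exists_linearEquiv_pi_residue hA
    refine ⟨_, (hK.pi s).congr_right e, ball_one.2 ⟨s,
      LinearMap.pi fun j => LinearMap.inl R K R ∘ₗ LinearMap.proj j,
      LinearMap.pi fun j => LinearMap.fst R K R ∘ₗ LinearMap.proj j, rfl⟩⟩
  induction n generalizing A with
  | zero => exact base A (by simpa using hA)
  | succ n ih =>
    let N : Submodule R A := maximalIdeal R • ⊤
    obtain ⟨L₁, hL₁, hb₁⟩ := ih (A := N) (by
      rintro y hy ⟨a, ha⟩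
      refine Subtype.ext ?_
      change y • a = 0
      refine Submodule.smul_induction_on ha (fun z hz b _ => ?_) fun b c hb hc => ?_
      · rw [smul_smul]
        refine hA _ ?_ b
        rw [pow_succ]
        exact Ideal.mul_mem_mul hy hz
      · rw [smul_add, hb, hc, add_zero])
    obtain ⟨L₂, hL₂, hb₂⟩ := base (A ⧸ N) (by
      intro y hy a
      obtain ⟨a, rfl⟩ := N.mkQ_surjective a
      rw [← map_smul]
      exact (Submodule.Quotient.mk_eq_zero _).2 (Submodule.smul_mem_smul hy trivial))
    obtain ⟨L, f, g, hL, hf, hg, hfg⟩ := IsSyzygyCat.horseshoe N.injective_subtype N.mkQ_surjective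
      (by rw [Submodule.range_subtype, Submodule.ker_mkQ]) hL₁ hL₂
    exact ⟨L, hL, ball_add_two.2
      ⟨L₁, L, L₂, f, g, hf, hg, hfg, hb₁, hb₂, LinearMap.id, LinearMap.id, rfl⟩⟩

end Balls

section RegularSequences

variable {R : Type} [CommRing R] {d : ℕ} {A B F : Type} [AddCommGroup A] [Module R A]
  [AddCommGroup B] [Module R B] [AddCommGroup F] [Module R F]

/-- The ideal generated by the first `j` terms of `x`. -/
def initialSpan (x : Fin d → R) (j : ℕ) : Ideal R :=
  Ideal.span (x '' {i | (i : ℕ) < j})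

/-- Each `x j` is a nonzerodivisor on the quotient by the previous terms. -/
def WeaklyRegularOn (x : Fin d → R) (A : Type) [AddCommGroup A] [Module R A] : Prop :=
  ∀ j : Fin d, IsSMulRegular (A ⧸ (initialSpan x j • ⊤ : Submodule R A)) (x j)

lemma initialSpan_zero (x : Fin d → R) : initialSpan x 0 = ⊥ := by
  simp [initialSpan]

lemma initialSpan_self (x : Fin d → R) : initialSpan x d = Ideal.span (Set.range x) := by
  simp [initialSpan]

lemma initialSpan_succ (x : Fin d → R) (j : Fin d) :
    initialSpan x (j + 1) = initialSpan x j ⊔ Ideal.span {x j} := by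
  rw [initialSpan, initialSpan, ← Ideal.span_union, ← Set.image_singleton, ← Set.image_union]
  congr 2
  ext i
  simp only [Set.mem_ofPred_eq, Set.mem_union, Set.mem_singleton_iff, Fin.ext_iff]
  omega

lemma mem_initialSpan_succ_smul {x : Fin d → R} {j : Fin d} {N : Submodule R A} {a : A} :
    a ∈ initialSpan x (j + 1) • N ↔ ∃ b ∈ N, a - x j • b ∈ initialSpan x j • N := by
  rw [initialSpan_succ, Submodule.sup_smul, Submodule.ideal_span_singleton_smul,
    Submodule.mem_sup]
  constructor
  · rintro ⟨y, hy, z, ⟨b, hb, rfl⟩, rfl⟩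
    exact ⟨b, hb, by simpa using hy⟩
  · rintro ⟨b, hb, h⟩
    exact ⟨_, h, x j • b, ⟨b, hb, rfl⟩, sub_add_cancel _ _⟩

/-- The quotient map from the quotient by the first `j` terms to that by the first `j + 1`. -/
lemma exists_quotient_initialSpan_succ (A : Type) [AddCommGroup A] [Module R A] (x : Fin d → R)
    (j : Fin d) :
    ∃ q : (A ⧸ (initialSpan x j • ⊤ : Submodule R A)) →ₗ[R]
      (A ⧸ (initialSpan x (j + 1) • ⊤ : Submodule R A)), Function.Surjective q ∧
      ∀ c, q c = 0 ↔ ∃ c', x j • c' = c := by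
  have hle : (initialSpan x j • ⊤ : Submodule R A) ≤ initialSpan x (j + 1) • ⊤ :=
    Submodule.smul_mono_left (by rw [initialSpan_succ]; exact le_sup_left)
  refine ⟨Submodule.factor hle, Submodule.factor_surjective hle, fun c => ?_⟩
  obtain ⟨a, rfl⟩ := Submodule.mkQ_surjective _ c
  rw [Submodule.mkQ_apply]
  change Submodule.Quotient.mk a = 0 ↔ _
  rw [Submodule.Quotient.mk_eq_zero,
    mem_initialSpan_succ_smul]
  constructor
  · rintro ⟨b, -, h⟩
    refine ⟨Submodule.Quotient.mk b, ?_⟩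
    rw [← Submodule.Quotient.mk_smul, eq_comm, Submodule.Quotient.eq]
    exact h
  · rintro ⟨c', h⟩
    obtain ⟨b, rfl⟩ := Submodule.mkQ_surjective _ c'
    refine ⟨b, trivial, ?_⟩
    rwa [Submodule.mkQ_apply, ← Submodule.Quotient.mk_smul, eq_comm, Submodule.Quotient.eq] at h

/-- A module stably annihilated by a regular sequence is stably a direct summand of a syzygy of
its quotient by that sequence. -/
lemma exists_syzygy_stablySummand [IsNoetherianRing R] [Module.Finite R A] {x : Fin d → R}
    (hreg : WeaklyRegularOn x A) (hann : ∀ i, StablyAnn R A (x i)) (j : ℕ) (hj : j ≤ d) :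
    ∃ K : ModuleCat.{0} R, Module.Finite R K ∧ StablySummand R A K ∧
      IsSyzygyCat R j K (ModuleCat.of R (A ⧸ (initialSpan x j • ⊤ : Submodule R A))) := by
  induction j with
  | zero =>
    refine ⟨ModuleCat.of R A, ‹_›, .rfl, ⟨(Submodule.quotEquivOfEqBot _ ?_).symm⟩⟩
    rw [initialSpan_zero, Submodule.bot_smul]
  | succ j ih =>
    obtain ⟨K, _, hAK, hK⟩ := ih (by omega)
    obtain ⟨s, π, hπ⟩ := exists_finite_free_lift (R := R) (A := K)
    obtain ⟨F, _, _, _, _, p, hp, h⟩ := hK.exists_smulPullback (x ⟨j, hj⟩) hπ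
    obtain ⟨q, hq, hker⟩ := exists_quotient_initialSpan_succ A x ⟨j, hj⟩
    exact ⟨_, inferInstanceAs (Module.Finite R (smulPullback (x ⟨j, hj⟩) π)),
      hAK.smulPullback (hann _) hπ, .succ_of_smulPullback hp hq hker (hreg ⟨j, hj⟩) h⟩

lemma mem_initialSpan_smul_ker {x : Fin d → R} (hreg : WeaklyRegularOn x A) {p : F →ₗ[R] A}
    (hp : Function.Surjective p) (j : ℕ) (hj : j ≤ d) (z : F) (hz : p z = 0)
    (h : z ∈ initialSpan x j • (⊤ : Submodule R F)) :
    z ∈ initialSpan x j • LinearMap.ker p := by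
  induction j generalizing z with
  | zero => simpa [initialSpan_zero] using h
  | succ j ih =>
    obtain ⟨b, -, hb⟩ := (mem_initialSpan_succ_smul (j := ⟨j, hj⟩)).1 h
    have hmap : ∀ w ∈ initialSpan x j • (⊤ : Submodule R F),
        p w ∈ initialSpan x j • (⊤ : Submodule R A) := fun w hw => by
      have := Submodule.mem_map_of_mem (f := p) hw
      rw [Submodule.map_smul''] at this
      exact Submodule.smul_mono le_rfl le_top this
    have h1 : p b ∈ initialSpan x j • (⊤ : Submodule R A) := by
      have h2 := hmap _ hb
      rw [map_sub, hz, zero_sub, Submodule.neg_mem_iff, map_smul] at h2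
      rw [← Submodule.Quotient.mk_eq_zero]
      refine hreg ⟨j, hj⟩ ?_
      change _ • _ = _ • _
      rw [smul_zero, ← Submodule.Quotient.mk_smul, Submodule.Quotient.mk_eq_zero]
      exact h2
    have h3 : p b ∈ (initialSpan x j • (⊤ : Submodule R F)).map p := by
      rwa [Submodule.map_smul'', Submodule.map_top, LinearMap.range_eq_top.2 hp]
    obtain ⟨w, hw, hwb⟩ := h3
    refine (mem_initialSpan_succ_smul (j := ⟨j, hj⟩)).2
      ⟨b - w, by simp [hwb], ih (by omega) _ (by simp [hz, hwb]) ?_⟩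
    have : z - x ⟨j, hj⟩ • (b - w) = (z - x ⟨j, hj⟩ • b) + x ⟨j, hj⟩ • w := by
      rw [smul_sub]
      abel
    rw [this]
    exact add_mem hb (Submodule.smul_mem _ _ hw)

end RegularSequences

section ExtVanishing

open CategoryTheory

variable {R : Type} [CommRing R]

/-- Vanishing of `Ext^i(N, M)`. -/
def ExtVanishes (R : Type) [CommRing R] (N M : Type) [AddCommGroup N] [Module R N]
    [AddCommGroup M] [Module R M] (i : ℕ) : Prop :=
  Subsingleton (Abelian.Ext (ModuleCat.of R N) (ModuleCat.of R M) i)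

variable {N N₁ N₂ N₃ M M₁ M₂ M₃ : Type} [AddCommGroup N] [Module R N] [AddCommGroup N₁]
  [Module R N₁] [AddCommGroup N₂] [Module R N₂] [AddCommGroup N₃] [Module R N₃] [AddCommGroup M]
  [Module R M] [AddCommGroup M₁] [Module R M₁] [AddCommGroup M₂] [Module R M₂] [AddCommGroup M₃]
  [Module R M₃]

/-- Vanishing of the derived functor `Ext` implies vanishing of `Abelian.Ext`. -/
lemma ExtVanishes.of_extMod {i : ℕ}
    (h : Subsingleton (ExtMod R i (ModuleCat.of R N) (ModuleCat.of R M))) :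
    ExtVanishes R N M i := by
  let P := projectiveResolution (ModuleCat.of R N)
  have h0 : Limits.IsZero ((P.complex.linearYonedaObj R (ModuleCat.of R M)).homology i) :=
    (@ModuleCat.isZero_of_subsingleton R _
      (ExtMod R i (ModuleCat.of R N) (ModuleCat.of R M)) h).of_iso (P.isoExt i _).symm
  rw [← HomologicalComplex.exactAt_iff_isZero_homology, HomologicalComplex.exactAt_iff,
    ShortComplex.moduleCat_exact_iff] at h0
  have hnext : (ComplexShape.up ℕ).next i = i + 1 := by simp
  refine subsingleton_of_forall_eq 0 fun α => ?_
  obtain ⟨f, hf, rfl⟩ := P.extMk_surjective α ((ComplexShape.up ℕ).next i) hnext.symm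
  obtain ⟨g, hg⟩ := h0 f hf
  cases i with
  | zero =>
    have : f = 0 := by
      rw [← hg]
      have : (P.complex.linearYonedaObj R (ModuleCat.of R M)).d
          ((ComplexShape.up ℕ).prev 0) 0 = 0 :=
        HomologicalComplex.shape _ _ _ (by simp)
      exact congrArg (fun φ => φ.hom g) this
    subst this
    exact P.extMk_zero _ _
  | succ i =>
    rw [P.extMk_eq_zero_iff f _ _ hf ((ComplexShape.up ℕ).prev (i + 1)) (by simp)]
    exact ⟨g, hg⟩

lemma shortExact_of_exact {f : N₁ →ₗ[R] N₂} {g : N₂ →ₗ[R] N₃} (hf : Function.Injective f)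
    (hg : Function.Surjective g) (hfg : Function.Exact f g) :
    (ShortComplex.mk (ModuleCat.ofHom f) (ModuleCat.ofHom g)
      (by ext a; exact hfg.apply_apply_eq_zero a)).ShortExact :=
  ModuleCat.shortComplex_shortExact _ hfg hf hg

lemma ExtVanishes.middle_left {f : N₁ →ₗ[R] N₂} {g : N₂ →ₗ[R] N₃} (hf : Function.Injective f)
    (hg : Function.Surjective g) (hfg : Function.Exact f g) {i : ℕ} (h₁ : ExtVanishes R N₁ M i)
    (h₃ : ExtVanishes R N₃ M i) : ExtVanishes R N₂ M i := by
  refine subsingleton_of_forall_eq 0 fun e => ?_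
  obtain ⟨e', rfl⟩ := Abelian.Ext.contravariant_sequence_exact₂ (shortExact_of_exact hf hg hfg) _ e
    (h₁.elim _ _)
  rw [h₃.elim e' 0, Abelian.Ext.comp_zero]

lemma ExtVanishes.right_right {f : M₁ →ₗ[R] M₂} {g : M₂ →ₗ[R] M₃} (hf : Function.Injective f)
    (hg : Function.Surjective g) (hfg : Function.Exact f g) {i : ℕ}
    (h₂ : ExtVanishes R N M₂ i) (h₁ : ExtVanishes R N M₁ (i + 1)) : ExtVanishes R N M₃ i := by
  refine subsingleton_of_forall_eq 0 fun e => ?_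
  obtain ⟨e', rfl⟩ := Abelian.Ext.covariant_sequence_exact₃ _ (shortExact_of_exact hf hg hfg) e rfl
    (h₁.elim _ _)
  rw [h₂.elim e' 0, Abelian.Ext.zero_comp]

lemma ExtVanishes.left_right {f : M₁ →ₗ[R] M₂} {g : M₂ →ₗ[R] M₃} (hf : Function.Injective f)
    (hg : Function.Surjective g) (hfg : Function.Exact f g) {i : ℕ}
    (h₂ : ExtVanishes R N M₂ i) (h₃ : ∀ j, j + 1 = i → ExtVanishes R N M₃ j) :
    ExtVanishes R N M₁ i := by
  refine subsingleton_of_forall_eq 0 fun e => ?_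
  cases i with
  | zero =>
    have : Mono (ModuleCat.ofHom f) := (ModuleCat.mono_iff_injective _).2 hf
    exact Abelian.Ext.postcomp_mk₀_injective_of_mono _ (ModuleCat.ofHom f) (h₂.elim _ _)
  | succ i =>
    obtain ⟨e', rfl⟩ := Abelian.Ext.covariant_sequence_exact₁ _ (shortExact_of_exact hf hg hfg) e
      (h₂.elim _ _) rfl
    rw [(h₃ i rfl).elim e' 0, Abelian.Ext.zero_comp]

lemma ExtVanishes.middle_right {f : M₁ →ₗ[R] M₂} {g : M₂ →ₗ[R] M₃} (hf : Function.Injective f)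
    (hg : Function.Surjective g) (hfg : Function.Exact f g) {i : ℕ}
    (h₁ : ExtVanishes R N M₁ i) (h₃ : ExtVanishes R N M₃ i) : ExtVanishes R N M₂ i := by
  refine subsingleton_of_forall_eq 0 fun e => ?_
  obtain ⟨e', rfl⟩ := Abelian.Ext.covariant_sequence_exact₂ _ (shortExact_of_exact hf hg hfg) e
    (h₃.elim _ _)
  rw [h₁.elim e' 0, Abelian.Ext.zero_comp]

lemma ExtVanishes.congr_left (e : N₁ ≃ₗ[R] N₂) {i : ℕ} (h : ExtVanishes R N₁ M i) :
    ExtVanishes R N₂ M i := by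
  refine subsingleton_of_forall_eq 0 fun α => ?_
  have h1 : (Abelian.Ext.mk₀ (ModuleCat.ofHom e.symm.toLinearMap)).comp
      ((Abelian.Ext.mk₀ (ModuleCat.ofHom e.toLinearMap)).comp α (zero_add i)) (zero_add i) = α := by
    rw [Abelian.Ext.mk₀_comp_mk₀_assoc]
    have : ModuleCat.ofHom e.symm.toLinearMap ≫ ModuleCat.ofHom e.toLinearMap = 𝟙 _ := by
      ext
      simp
    rw [this, Abelian.Ext.mk₀_id_comp]
  rw [← h1, h.elim ((Abelian.Ext.mk₀ (ModuleCat.ofHom e.toLinearMap)).comp α (zero_add i)) 0,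
    Abelian.Ext.comp_zero]

lemma ExtVanishes.of_subsingleton [Subsingleton N] (i : ℕ) : ExtVanishes R N M i := by
  refine subsingleton_of_forall_eq 0 fun α => ?_
  have : 𝟙 (ModuleCat.of R N) = 0 := by
    ext
    exact Subsingleton.elim _ _
  rw [← Abelian.Ext.mk₀_id_comp α, this, Abelian.Ext.mk₀_zero, Abelian.Ext.zero_comp]

lemma ExtVanishes.of_subsingleton_right [Subsingleton M] (i : ℕ) : ExtVanishes R N M i := by
  refine subsingleton_of_forall_eq 0 fun α => ?_
  have : 𝟙 (ModuleCat.of R M) = 0 := by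
    ext
    exact Subsingleton.elim _ _
  rw [← Abelian.Ext.comp_mk₀_id α, this, Abelian.Ext.mk₀_zero, Abelian.Ext.comp_zero]

lemma ExtVanishes.pi {i : ℕ} (h : ExtVanishes R N M i) (s : ℕ) :
    ExtVanishes R N (Fin s → M) i := by
  induction s with
  | zero => exact .of_subsingleton_right i
  | succ s ih =>
    let e := Fin.consLinearEquiv R (fun _ : Fin (s + 1) => M)
    refine ExtVanishes.middle_right (f := e.toLinearMap ∘ₗ LinearMap.inl R M (Fin s → M))
      (g := LinearMap.snd R M (Fin s → M) ∘ₗ e.symm.toLinearMap)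
      (e.injective.comp LinearMap.inl_injective) (Prod.snd_surjective.comp e.symm.surjective) ?_
      h ih
    rw [LinearMap.exact_iff]
    ext z
    obtain ⟨⟨a, b⟩, rfl⟩ := e.surjective z
    simp [Prod.ext_iff, eq_comm]

lemma ExtVanishes.eq_zero (h : ExtVanishes R N M 0) (f : N →ₗ[R] M) : f = 0 := by
  have := (Abelian.Ext.mk₀_eq_zero_iff (ModuleCat.ofHom f)).1 (h.elim _ _)
  exact congrArg ModuleCat.Hom.hom this

lemma exact_smul_mkQ (y : R) : Function.Exact (y • LinearMap.id : N →ₗ[R] N)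
    (LinearMap.range (y • LinearMap.id : N →ₗ[R] N)).mkQ :=
  LinearMap.exact_iff.2 (Submodule.ker_mkQ _)

lemma ExtVanishes.exists_smul_eq {y : R} (hy : IsSMulRegular N y) {i : ℕ}
    (h : ExtVanishes R (N ⧸ LinearMap.range (y • LinearMap.id : N →ₗ[R] N)) M (i + 1))
    (e : Abelian.Ext (ModuleCat.of R N) (ModuleCat.of R M) i) : ∃ e', y • e' = e := by
  obtain ⟨e', he'⟩ := Abelian.Ext.contravariant_sequence_exact₁
    (shortExact_of_exact (f := (y • LinearMap.id : N →ₗ[R] N)) (fun _ _ hab => hy hab)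
      (Submodule.mkQ_surjective _)
      (exact_smul_mkQ y)) _ e
    (add_comm 1 i) (h.elim _ _)
  refine ⟨e', ?_⟩
  rw [← he']
  have : ModuleCat.ofHom (y • LinearMap.id : N →ₗ[R] N) = y • 𝟙 _ := rfl
  simp [this, Abelian.Ext.mk₀_smul]

lemma finite_ext [IsNoetherianRing R] [Module.Finite R N] [Module.Finite R M] (i : ℕ) :
    Module.Finite R (Abelian.Ext (ModuleCat.of R N) (ModuleCat.of R M) i) := by
  induction i generalizing N with
  | zero =>
    exact Module.Finite.equiv ((Abelian.Ext.linearEquiv₀ (R := R) (X := ModuleCat.of R N)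
      (Y := ModuleCat.of R M)).trans ModuleCat.homLinearEquiv).symm
  | succ i ih =>
    obtain ⟨s, p, hp⟩ := Module.Finite.exists_fin' R N
    have hS := LinearMap.shortExact_shortComplexKer hp
    have : Projective (ModuleCat.of R (Fin s → R)) := (ModuleCat.projective_of_free
      (Pi.basisFun R (Fin s)))
    have := ih (N := LinearMap.ker p)
    refine Module.Finite.of_surjective (Abelian.Ext.bilinearCompOfLinear R _ _ (ModuleCat.of R M) 1
      i (i + 1) (add_comm 1 i) hS.extClass) fun e => ?_
    exact Abelian.Ext.contravariant_sequence_exact₃ hS _ e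
      (Abelian.Ext.eq_zero_of_projective (P := ModuleCat.of R (Fin s → R)) _) (add_comm 1 i)

end ExtVanishing

section Regularity

open IsLocalRing

variable {R : Type} [CommRing R]

/-- `Ext^i(N, M)` vanishes for all `i < n` and all finite modules `N` killed by a power of `J`. -/
def TorsionExtVanishes (R : Type) [CommRing R] (J : Ideal R) (n : ℕ) (M : Type) [AddCommGroup M]
    [Module R M] : Prop :=
  ∀ (N : Type) [AddCommGroup N] [Module R N] [Module.Finite R N],
    (∃ t, ∀ y ∈ J ^ t, ∀ a : N, y • a = 0) → ∀ i < n, ExtVanishes R N M i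

variable {M : Type} [AddCommGroup M] [Module R M]

lemma TorsionExtVanishes.of_residue [IsNoetherianRing R] [IsLocalRing R] {n : ℕ}
    (h : ∀ i < n, ExtVanishes R (R ⧸ maximalIdeal R) M i) :
    TorsionExtVanishes R (maximalIdeal R) n M := by
  intro N _ _ hN
  induction hN using IsNoetherianRing.induction_on_isQuotientEquivQuotientPrime R with
  | subsingleton N => exact fun _ i _ => .of_subsingleton i
  | quotient N p e =>
    rintro ⟨t, ht⟩ i hi
    have hle : maximalIdeal R ^ t ≤ p.1 := by
      intro y hy
      have := ht y hy (e.symm 1)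
      rw [← map_smul, LinearEquiv.map_eq_zero_iff] at this
      rwa [Algebra.smul_def, mul_one, Ideal.Quotient.algebraMap_eq,
        Ideal.Quotient.eq_zero_iff_mem] at this
    have hp : maximalIdeal R = p.1 :=
      le_antisymm (p.2.le_of_pow_le hle) (le_maximalIdeal p.2.ne_top)
    exact (h i hi).congr_left ((Submodule.quotEquivOfEq _ _ hp).trans e.symm)
  | exact N₁ N₂ N₃ f g hf hg hfg h₁ h₃ =>
    rintro ⟨t, ht⟩ i hi
    refine ExtVanishes.middle_left hf hg hfg (h₁ ⟨t, fun y hy a => hf ?_⟩ i hi)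
      (h₃ ⟨t, fun y hy a => ?_⟩ i hi)
    · rw [map_smul, ht y hy, map_zero]
    · obtain ⟨b, rfl⟩ := hg a
      rw [← map_smul, ht y hy, map_zero]

lemma TorsionExtVanishes.of_pow_le {J J' : Ideal R} {n r : ℕ} (h : TorsionExtVanishes R J n M)
    (hle : J ^ r ≤ J') : TorsionExtVanishes R J' n M := by
  rintro N _ _ _ ⟨t, ht⟩ i hi
  exact h N ⟨r * t, fun y hy => ht y (Ideal.pow_right_mono hle t (by rwa [← pow_mul]))⟩ i hi

lemma TorsionExtVanishes.of_sup_span_singleton [IsNoetherianRing R] [IsLocalRing R]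
    [Module.Finite R M] {J : Ideal R} {y : R} (hy : y ∈ maximalIdeal R) {n : ℕ}
    (h : TorsionExtVanishes R (J ⊔ Ideal.span {y}) (n + 1) M) : TorsionExtVanishes R J n M := by
  rintro N _ _ _ ⟨t, ht⟩ i hi
  have hkill (k : ℕ) (a : R) (ha : a ∈ (J ⊔ Ideal.span {y}) ^ (t + k)) :
      ∃ b ∈ J ^ t, ∃ c, a = b + c * y ^ k := by
    obtain ⟨b, hb, c, hc, rfl⟩ := Submodule.mem_sup.1 (Ideal.sup_pow_add_le_pow_sup_pow ha)
    rw [Ideal.span_singleton_pow] at hc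
    obtain ⟨e, rfl⟩ := Ideal.mem_span_singleton'.1 hc
    exact ⟨b, hb, e, rfl⟩
  let φ : N →ₗ[R] N := y • LinearMap.id
  have hφ (k : ℕ) (a : N) : (φ ^ k) a = y ^ k • a := by
    simp only [φ, smul_pow, LinearMap.smul_apply]
    rw [← Module.End.one_eq_id, one_pow, Module.End.one_apply]
  obtain ⟨k, hk⟩ := monotone_stabilizes_iff_noetherian.mpr inferInstance φ.iterateKer
  let T : Submodule R N := φ.iterateKer k
  have hT (a : N) : a ∈ T ↔ y ^ k • a = 0 := by
    rw [← hφ]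
    rfl
  have hreg : IsSMulRegular (N ⧸ T) y := by
    rw [isSMulRegular_iff_right_eq_zero_of_smul]
    intro a ha
    obtain ⟨a, rfl⟩ := T.mkQ_surjective a
    rw [← map_smul, Submodule.mkQ_apply, Submodule.Quotient.mk_eq_zero, hT, smul_smul,
      ← pow_succ, ← hφ] at ha
    rw [Submodule.mkQ_apply, Submodule.Quotient.mk_eq_zero]
    change a ∈ φ.iterateKer k
    rw [hk (k + 1) k.le_succ]
    exact ha
  refine ExtVanishes.middle_left T.injective_subtype T.mkQ_surjective
    (LinearMap.exact_subtype_mkQ T) (h T ⟨t + k, fun a ha b => ?_⟩ i (by omega)) ?_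
  · obtain ⟨a, haJ, c, rfl⟩ := hkill k a ha
    ext
    simp [add_smul, ht a haJ, mul_smul, (hT b).1 b.2]
  · have hdiv := ExtVanishes.exists_smul_eq hreg (h _ ⟨t + 1, fun a ha b => ?_⟩ (i + 1) (by omega))
    · have := finite_ext (R := R) (N := N ⧸ T) (M := M) i
      have hbot := Submodule.eq_bot_of_le_smul_of_le_jacobson_bot (Ideal.span {y})
        (⊤ : Submodule R (CategoryTheory.Abelian.Ext (ModuleCat.of R (N ⧸ T)) (ModuleCat.of R M) i))
        Module.Finite.fg_top (fun e _ => by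
          obtain ⟨e', rfl⟩ := hdiv e
          exact Submodule.smul_mem_smul (Ideal.mem_span_singleton_self y) trivial)
        (by
          rw [IsLocalRing.jacobson_eq_maximalIdeal _ bot_ne_top]
          simpa [Ideal.span_le] using hy)
      exact (Submodule.subsingleton_iff R).1 (subsingleton_of_bot_eq_top hbot.symm)
    · obtain ⟨a, haJ, c, rfl⟩ := hkill 1 a ha
      obtain ⟨b, rfl⟩ := Submodule.mkQ_surjective _ b
      obtain ⟨b, rfl⟩ := T.mkQ_surjective b
      rw [add_smul, ← map_smul, ← map_smul, ht a haJ, map_zero, map_zero, zero_add, ← map_smul,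
        Submodule.mkQ_apply, Submodule.Quotient.mk_eq_zero]
      exact ⟨c • T.mkQ b, by simp [smul_smul, mul_comm]⟩

variable [IsNoetherianRing R] [IsLocalRing R] {d : ℕ} {x : Fin d → R}

lemma TorsionExtVanishes.initialSpan_of_add [Module.Finite R M]
    (hx : ∀ i, x i ∈ maximalIdeal R) {n j : ℕ} (k : ℕ) (hjk : j + k ≤ d)
    (h : TorsionExtVanishes R (initialSpan x (j + k)) (n + k) M) :
    TorsionExtVanishes R (initialSpan x j) n M := by
  induction k with
  | zero => exact h
  | succ k ih =>
    refine ih (by omega) (.of_sup_span_singleton (hx ⟨j + k, by omega⟩) ?_)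
    have := initialSpan_succ x ⟨j + k, by omega⟩
    exact this ▸ h

lemma TorsionExtVanishes.isSMulRegular [Module.Finite R M] (hx : ∀ i, x i ∈ maximalIdeal R)
    (j : Fin d) (h : TorsionExtVanishes R (initialSpan x d) (d - j) M)
    (hM : ∀ y ∈ initialSpan x j, ∀ a : M, y • a = 0) : IsSMulRegular M (x j) := by
  have h1 : TorsionExtVanishes R (initialSpan x (j + 1)) 1 M := by
    refine .initialSpan_of_add hx (d - (j + 1)) (by omega) ?_
    rwa [show (j : ℕ) + 1 + (d - (j + 1)) = d by omega,
      show 1 + (d - (j + 1)) = d - (j : ℕ) by omega]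
  rw [isSMulRegular_iff_right_eq_zero_of_smul]
  intro c hc
  have hle : initialSpan x (j + 1) ≤ (Submodule.span R {c}).annihilator := by
    rw [initialSpan_succ, Submodule.annihilator_span_singleton, sup_le_iff]
    refine ⟨fun y hy => by simpa using hM y hy c, ?_⟩
    simpa [Ideal.span_le] using hc
  have h0 := (h1 (Submodule.span R {c}) ⟨1, fun y hy a => by
    rw [pow_one] at hy
    ext
    exact Submodule.mem_annihilator.1 (hle hy) a a.2⟩ 0 one_pos).eq_zero (Submodule.subtype _)
  exact LinearMap.congr_fun h0 ⟨c, Submodule.mem_span_singleton_self c⟩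

lemma TorsionExtVanishes.weaklyRegularOn [Module.Finite R M] (hx : ∀ i, x i ∈ maximalIdeal R)
    (h : TorsionExtVanishes R (initialSpan x d) d M) : WeaklyRegularOn x M := by
  have hkill (j : ℕ) (y : R) (hy : y ∈ initialSpan x j)
      (a : M ⧸ (initialSpan x j • ⊤ : Submodule R M)) : y • a = 0 := by
    obtain ⟨a, rfl⟩ := Submodule.mkQ_surjective _ a
    rw [← map_smul, Submodule.mkQ_apply, Submodule.Quotient.mk_eq_zero]
    exact Submodule.smul_mem_smul hy trivial
  have key (j : ℕ) (hj : j ≤ d) : TorsionExtVanishes R (initialSpan x d) (d - j)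
      (M ⧸ (initialSpan x j • ⊤ : Submodule R M)) := by
    induction j with
    | zero =>
      intro N _ _ _ hN i hi
      refine ExtVanishes.right_right (M₁ := PUnit) (M₂ := M) (f := 0)
        (g := Submodule.mkQ (initialSpan x 0 • ⊤)) (Function.injective_of_subsingleton _)
        (Submodule.mkQ_surjective _) ?_ (h N hN i hi) (.of_subsingleton_right _)
      rw [LinearMap.exact_iff, Submodule.ker_mkQ, initialSpan_zero, Submodule.bot_smul,
        LinearMap.range_zero]
    | succ j ih =>
      intro N _ _ _ hN i hi
      have hj' := ih (by omega)
      obtain ⟨q, hq, hq'⟩ := exists_quotient_initialSpan_succ M x ⟨j, hj⟩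
      exact ExtVanishes.right_right
        (f := LinearMap.lsmul R (M ⧸ (initialSpan x j • ⊤ : Submodule R M)) (x ⟨j, hj⟩))
        (fun a b hab => hj'.isSMulRegular hx ⟨j, hj⟩ (hkill j) hab) hq (fun c => hq' c)
        (hj' N hN i (by omega)) (hj' N hN (i + 1) (by omega))
  exact fun j => (key j j.2.le).isSMulRegular hx j (hkill j)

end Regularity

section MinimalCover

open IsLocalRing TensorProduct

variable {R : Type} [CommRing R] [IsLocalRing R]

/-- A finite module over a local ring has a minimal free cover. -/
lemma exists_minimal_cover (M : Type) [AddCommGroup M] [Module R M] [Module.Finite R M] :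
    ∃ (s : ℕ) (p : (Fin s → R) →ₗ[R] M), Function.Surjective p ∧
      LinearMap.ker p ≤ maximalIdeal R • ⊤ := by
  let b := Module.finBasis (ResidueField R) (ResidueField R ⊗[R] M)
  have hsurj : Function.Surjective (TensorProduct.mk R (ResidueField R) M 1) :=
    TensorProduct.mk_surjective R M _ Ideal.Quotient.mk_surjective
  choose f hf using fun i => hsurj (b i)
  refine ⟨_, Fintype.linearCombination R f, ?_, fun z hz => ?_⟩
  · rw [← LinearMap.range_eq_top, Fintype.range_linearCombination]
    exact span_eq_top_of_tmul_eq_basis f b hf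
  · have hz' : ∑ i, residue R (z i) • b i = 0 := by
      have := congrArg (TensorProduct.mk R (ResidueField R) M 1) (LinearMap.mem_ker.1 hz)
      rw [Fintype.linearCombination_apply, map_sum, map_zero] at this
      rw [← this]
      refine Finset.sum_congr rfl fun i _ => ?_
      rw [map_smul, hf, ← algebraMap_smul (ResidueField R) (z i) (b i)]
      rfl
    have hzm (i) : z i ∈ maximalIdeal R := by
      rw [← residue_eq_zero_iff]
      exact Fintype.linearIndependent_iff.1 b.linearIndependent _ hz' i
    rw [pi_eq_sum_univ' z]
    refine Submodule.sum_mem _ fun i _ => Submodule.smul_mem_smul (hzm i) trivial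

lemma pow_smul_quotient_ker_eq_zero {d : ℕ} {x : Fin d → R} {n s : ℕ} {M : Type} [AddCommGroup M]
    [Module R M] (hreg : WeaklyRegularOn x M) (hx : maximalIdeal R ^ (n + 1) ≤ initialSpan x d)
    {p : (Fin s → R) →ₗ[R] M} (hp : Function.Surjective p)
    (hmin : LinearMap.ker p ≤ maximalIdeal R • ⊤) (y : R) (hy : y ∈ maximalIdeal R ^ n)
    (a : LinearMap.ker p ⧸ (initialSpan x d • ⊤ : Submodule R (LinearMap.ker p))) : y • a = 0 := by
  obtain ⟨z, rfl⟩ := Submodule.mkQ_surjective _ a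
  rw [← map_smul, Submodule.mkQ_apply, Submodule.Quotient.mk_eq_zero, Submodule.mem_smul_top_iff]
  refine mem_initialSpan_smul_ker hreg hp d le_rfl _ (y • z).2 ?_
  have := Submodule.smul_mem_smul hy (hmin z.2)
  rw [← Submodule.mul_smul, ← pow_succ] at this
  exact Submodule.smul_mono_left hx this

end MinimalCover


open IsLocalRing in
/-- Main theorem, part (1): over a CM local ring of dimension d, if x is a system of
parameters with m^r ⊆ (x) ⊆ I for an m-primary ideal I, then the first syzygy of any
maximal Cohen-Macaulay module stably annihilated by I lies in the class built from
the d-th syzygy of k together with R by r-2 extensions, finite direct sums and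
direct summands. -/
theorem syzygy_in_ball (R : Type) [CommRing R] [IsNoetherianRing R] [IsLocalRing R]
    (d : ℕ) (hdim : ringKrullDim R = d)
    (hCMring : ∀ i < d,
      Subsingleton (ExtMod R i (ModuleCat.of R (R ⧸ maximalIdeal R)) (ModuleCat.of R R)))
    (I : Ideal R) (hIprimary : I.radical = maximalIdeal R)
    (r : ℕ) (hr : 1 ≤ r) (x : Fin d → R)
    (h1 : maximalIdeal R ^ r ≤ Ideal.span (Set.range x))
    (h2 : Ideal.span (Set.range x) ≤ I)
    (M : Type) [AddCommGroup M] [Module R M] [Module.Finite R M]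
    (hMCM : ∀ i < d,
      Subsingleton (ExtMod R i (ModuleCat.of R (R ⧸ maximalIdeal R)) (ModuleCat.of R M)))
    (hann : ∀ a ∈ I, StablyAnn R M a) :
    ∀ K : ModuleCat.{0} R, IsSyzygyCat R d K (ModuleCat.of R (R ⧸ maximalIdeal R)) →
      ∃ S : ModuleCat.{0} R, IsSyzygyCat R 1 S (ModuleCat.of R M) ∧
        Ball R (ModuleCat.of R ((K × R : Type))) (r - 1) S := by
  intro K hK
  have hspan : initialSpan x d = Ideal.span (Set.range x) := initialSpan_self x
  have hxI (i : Fin d) : x i ∈ I := h2 (Ideal.subset_span ⟨i, rfl⟩)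
  have hxm (i : Fin d) : x i ∈ maximalIdeal R := hIprimary ▸ Ideal.le_radical (hxI i)
  have hxm' : initialSpan x d ≤ maximalIdeal R := by
    rw [hspan, Ideal.span_le]
    rintro _ ⟨i, rfl⟩
    exact hxm i
  have regular {A : Type} [AddCommGroup A] [Module R A] [Module.Finite R A]
      (hA : ∀ i < d, ExtVanishes R (R ⧸ maximalIdeal R) A i) : WeaklyRegularOn x A :=
    ((TorsionExtVanishes.of_residue hA).of_pow_le (hspan ▸ h1)).weaklyRegularOn hxm
  obtain ⟨s, p, hp, hmin⟩ := exists_minimal_cover (R := R) M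
  have hregM : WeaklyRegularOn x M := regular fun i hi => .of_extMod (hMCM i hi)
  have hregS : WeaklyRegularOn x (LinearMap.ker p) := regular fun i hi =>
    .left_right (LinearMap.ker p).injective_subtype hp (LinearMap.exact_subtype_ker_map p)
      (ExtVanishes.pi (.of_extMod (hCMring i hi)) s) fun j hj => .of_extMod (hMCM j (by omega))
  refine ⟨ModuleCat.of R (LinearMap.ker p), ⟨s, p, hp, ⟨.refl R _⟩⟩, ?_⟩
  obtain ⟨n, rfl⟩ := Nat.exists_eq_add_of_le' hr
  have hkill := pow_smul_quotient_ker_eq_zero hregM (hspan ▸ h1) hp hmin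
  rw [Nat.add_sub_cancel]
  cases n with
  | zero =>
    rw [Ball]
    have hbot := Submodule.eq_bot_of_le_smul_of_le_jacobson_bot (initialSpan x d)
      (⊤ : Submodule R (LinearMap.ker p)) Module.Finite.fg_top (fun z _ => by
        have := hkill 1 (by simp) (Submodule.Quotient.mk z)
        rwa [one_smul, Submodule.Quotient.mk_eq_zero] at this)
      (by rwa [IsLocalRing.jacobson_eq_maximalIdeal _ bot_ne_top])
    exact (Submodule.subsingleton_iff R).1 (subsingleton_of_bot_eq_top hbot.symm)
  | succ n =>
    obtain ⟨L, hL, hball⟩ := exists_syzygy_ball hK n hkill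
    obtain ⟨K', -, hSK', hK'⟩ := exists_syzygy_stablySummand hregS
      (fun i => (hann (x i) (hxI i)).ker hp) d le_rfl
    exact .of_stablySummand (hSK'.trans (StablySummand.rfl.syzygy hK' hL)) hball
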